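/- Let G be a finitely generated group and let T and T' be minimal G-trees such that no edge stabilizer of T is contained with infinite index in an edge stabilizer of T'. If T dominates T', then B(T') ⊆ B(T). -/

import Mathlib

open scoped Pointwise symmDiff

namespace SSRN

section Group
variable {G : Type*} [Group G]

/-- A subset of `G` is `H`-finite if it is contained in finitely many orbits of the
action of `H` on `G` by left multiplication. -/
def HFin (H : Subgroup G) (X : Set G) : Prop :=
  ∃ F : Finset G, X ⊆ ⋃ f ∈ F, (· * f) '' (H : Set G)

/-- Two subsets of `G` are `H`-equivalent if their symmetric difference is `H`-finite. -/
def AIEquiv (H : Subgroup G) (X Y : Set G) : Prop := HFin H (X ∆ Y)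

/-- `X` is an `H`-almost invariant subset of `G`. -/
def IsAI (H : Subgroup G) (X : Set G) : Prop :=
  (∀ h ∈ H, (h * ·) '' X = X) ∧ ∀ s : G, HFin H (((· * s) '' X) ∆ X)

/-- `X` is a non-trivial `H`-almost invariant subset of `G`. -/
def NontrivAI (H : Subgroup G) (X : Set G) : Prop :=
  IsAI H X ∧ ¬ HFin H X ∧ ¬ HFin H Xᶜ

/-- The `H`-almost invariant set `X` crosses `Y`: none of the four corners is `H`-finite. -/
def Crosses (H : Subgroup G) (X Y : Set G) : Prop :=
  ¬ HFin H (X ∩ Y) ∧ ¬ HFin H (X ∩ Yᶜ) ∧ ¬ HFin H (Xᶜ ∩ Y) ∧ ¬ HFin H (Xᶜ ∩ Yᶜ)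

/-- Crossing of (non-trivial) almost invariant sets, quantifying over the groups over
which they are almost invariant. -/
def CrossesAny (X X' : Set G) : Prop :=
  ∃ H K : Subgroup G, NontrivAI H X ∧ NontrivAI K X' ∧ Crosses H X X'

/-- `X` and `X'` determine the same unordered pair `{[X], [X*]}` of equivalence classes. -/
def SamePair (X X' : Set G) : Prop :=
  ∃ H : Subgroup G, NontrivAI H X ∧ (HFin H (X ∆ X') ∨ HFin H (X ∆ X'ᶜ))

/-- An admissible family of subgroups: conjugacy invariant, closed under commensurability,
and no member contains another with infinite index. -/
def Admissible (E : Set (Subgroup G)) : Prop :=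
  (∀ H ∈ E, ∀ g : G, (MulAut.conj g • H) ∈ E) ∧
  (∀ H ∈ E, ∀ K : Subgroup G, Subgroup.Commensurable K H → K ∈ E) ∧
  (∀ A ∈ E, ∀ B ∈ E, A ≤ B → A.relIndex B ≠ 0)

end Group

section Tree

variable {V : Type*}

/-- The stabilizer of an edge `e : Sym2 V` under the action of `G`. -/
def edgeStab (G : Type*) [Group G] [MulAction G V] (e : Sym2 V) : Subgroup G where
  carrier := {g | Sym2.map (g • ·) e = e}
  one_mem' := by
    show Sym2.map ((1 : G) • ·) e = e
    have : ((1 : G) • · : V → V) = id := by funext v; simp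
    rw [this, Sym2.map_id]; rfl
  mul_mem' := by
    intro a b ha hb
    show Sym2.map ((a * b) • ·) e = e
    have : ((a * b) • · : V → V) = (a • ·) ∘ (b • ·) := by funext v; simp [mul_smul]
    rw [this, ← Sym2.map_map, hb, ha]
  inv_mem' := by
    intro a ha
    show Sym2.map (a⁻¹ • ·) e = e
    conv_lhs => rw [← ha]
    rw [Sym2.map_map]
    have : ((a⁻¹ • ·) ∘ (a • ·) : V → V) = id := by funext v; simp
    rw [this, Sym2.map_id]; rfl

variable (T : SimpleGraph V)

/-- `G` acts on the graph `T` by graph automorphisms. -/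
def ActsOn (G : Type*) [Group G] [MulAction G V] : Prop :=
  ∀ (g : G) (u v : V), T.Adj u v → T.Adj (g • u) (g • v)

/-- The action of `G` on `T` is without inversions. -/
def NoInversions (G : Type*) [Group G] [MulAction G V] : Prop :=
  ∀ (g : G) (u v : V), T.Adj u v → ¬ (g • u = v ∧ g • v = u)

/-- `w` lies between `u` and `v`: it is on every path from `u` to `v`. -/
def Btw (u w v : V) : Prop := ∀ p : T.Walk u v, p.IsPath → w ∈ p.support

/-- The action of `G` on the tree `T` is minimal: every nonempty invariant subtree
(convex invariant set of vertices) is the whole vertex set. -/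
def MinimalAction (G : Type*) [Group G] [MulAction G V] : Prop :=
  ∀ A : Set V, A.Nonempty → (∀ (g : G), ∀ a ∈ A, g • a ∈ A) →
    (∀ u ∈ A, ∀ v ∈ A, ∀ w : V, Btw T u w v → w ∈ A) → A = Set.univ

/-- The action of `G` is non-trivial: there is no global fixed vertex. -/
def NontrivialAction (G : Type*) [Group G] [MulAction G V] : Prop :=
  ¬ ∃ v : V, ∀ g : G, g • v = v

/-- `T` is an `E`-tree: all edge stabilizers belong to `E`. -/
def IsETree (G : Type*) [Group G] [MulAction G V] (E : Set (Subgroup G)) : Prop :=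
  ∀ e ∈ T.edgeSet, edgeStab G e ∈ E

/-- There are finitely many `G`-orbits of edges. -/
def FinEdgeOrbits (G : Type*) [Group G] [MulAction G V] : Prop :=
  ∃ F : Finset (Sym2 V), ∀ e ∈ T.edgeSet, ∃ e₀ ∈ F, ∃ g : G, Sym2.map (g • ·) e₀ = e

/-- A cylinder of `T`: an equivalence class of edges for commensurability of stabilizers. -/
def IsCylinder (G : Type*) [Group G] [MulAction G V] (Y : Set (Sym2 V)) : Prop :=
  Y.Nonempty ∧ Y ⊆ T.edgeSet ∧
    ∀ e ∈ Y, ∀ e' ∈ T.edgeSet,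
      (e' ∈ Y ↔ Subgroup.Commensurable (edgeStab G e) (edgeStab G (V := V) e'))

/-- The set of vertices of a set of edges (e.g. of a cylinder). -/
def cylVerts (Y : Set (Sym2 V)) : Set V := {v | ∃ e ∈ Y, v ∈ e}

/-- The boundary of a cylinder: its vertices lying in another cylinder,
i.e. incident to an edge outside the cylinder. -/
def cylBoundary (Y : Set (Sym2 V)) : Set V :=
  {v | v ∈ cylVerts Y ∧ ∃ e ∈ T.edgeSet, v ∈ e ∧ e ∉ Y}

/-- `H` belongs to the commensurability class associated to the cylinder `Y`. -/
def InClassOf (G : Type*) [Group G] [MulAction G V] (Y : Set (Sym2 V)) (H : Subgroup G) : Prop :=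
  ∃ e ∈ Y, Subgroup.Commensurable H (edgeStab G e)

/-- The coboundary of a set of vertices: edges with exactly one endpoint in it. -/
def cobdry (S : Set V) : Set (Sym2 V) :=
  {e | e ∈ T.edgeSet ∧ ∃ u v : V, e = s(u, v) ∧ u ∈ S ∧ v ∉ S}

/-- `S` is a special forest based on the cylinder `Y`. -/
def IsSpecialForest (S : Set V) (Y : Set (Sym2 V)) : Prop :=
  (cobdry T S).Finite ∧ cobdry T S ⊆ Y

/-- A set of vertices is non-trivial if it is neither finite nor cofinite. -/
def NontrivForest (S : Set V) : Prop := ¬ S.Finite ∧ ¬ (Sᶜ : Set V).Finite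

/-- The almost invariant set associated to a set of vertices. -/
def XS (G : Type*) [Group G] [MulAction G V] (v₀ : V) (S : Set V) : Set G :=
  {g : G | g • v₀ ∈ S}

/-- The component `T_e` of `T` minus the open edge `e = s(u,v)` containing the terminal
vertex `v`. -/
def halfTree (u v : V) : Set V :=
  {w | ∃ p : T.Walk v w, p.IsPath ∧ s(u, v) ∉ p.edges}

/-- The almost invariant set `Z_e` dual to the oriented edge `(u, v)`. -/
def Ze (G : Type*) [Group G] [MulAction G V] (v₀ u v : V) : Set G :=
  XS G v₀ (halfTree T u v)

/-- `v` has finitely many incident edges in `Y`. -/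
def FiniteValenceIn (Y : Set (Sym2 V)) (v : V) : Prop := {e | e ∈ Y ∧ v ∈ e}.Finite

/-- The peripheral special forest `S_{v,Y}`: the component of `v` in `T` minus the open
edges of `Y` incident to `v`. -/
def periForest (Y : Set (Sym2 V)) (v : V) : Set V :=
  {w | ∃ p : T.Walk v w, p.IsPath ∧ ∀ e ∈ Y, v ∈ e → e ∉ p.edges}

/-- The peripheral almost invariant set `X_{v,Y}`. -/
def XvY (G : Type*) [Group G] [MulAction G V] (v₀ : V) (Y : Set (Sym2 V)) (v : V) : Set G :=
  XS G v₀ (periForest T Y v)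

/-- A peripheral special forest: one equivalent to some `S_{v,Y}`. -/
def PeripheralForest (G : Type*) [Group G] [MulAction G V] (S : Set V) : Prop :=
  ∃ (Y : Set (Sym2 V)) (v : V), IsCylinder T G Y ∧ v ∈ cylBoundary T Y ∧
    FiniteValenceIn Y v ∧ (S ∆ periForest T Y v).Finite

/-- The Boolean algebra `B_C(T)` of (representatives of) almost invariant sets based on the
cylinder `Y`: the smallest family containing the sets `Z_e`, `e ∈ Y`, closed under
complement, intersection and `H`-equivalence. -/
def BCT {G : Type*} [Group G] [MulAction G V] (v₀ : V) (Y : Set (Sym2 V)) (H : Subgroup G) :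
    Set (Set G) :=
  ⋂₀ {F : Set (Set G) |
    (∀ u v : V, T.Adj u v → s(u, v) ∈ Y → Ze T G v₀ u v ∈ F) ∧
    (∀ X ∈ F, Xᶜ ∈ F) ∧
    (∀ X ∈ F, ∀ X' ∈ F, X ∩ X' ∈ F) ∧
    (∀ X ∈ F, ∀ X' : Set G, HFin H (X ∆ X') → X' ∈ F)}

/-- The set `B(T)` of (representatives of) almost invariant sets based on `T`. -/
def BT (G : Type*) [Group G] [MulAction G V] (v₀ : V) : Set (Set G) :=
  {X | ∃ Y : Set (Sym2 V), IsCylinder T G Y ∧ ∃ e ∈ Y, X ∈ BCT T v₀ Y (edgeStab G e)}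

/-- Elements of `B(T)` that are non-trivial almost invariant sets. -/
def NontrivB (G : Type*) [Group G] [MulAction G V] (v₀ : V) : Set (Set G) :=
  {X | X ∈ BT T G v₀ ∧ ∃ H : Subgroup G, NontrivAI H X}

/-- One step of the relation generating cross-connected components. -/
def ccStep (G : Type*) [Group G] [MulAction G V] (v₀ : V) (X X' : Set G) : Prop :=
  X ∈ NontrivB T G v₀ ∧ X' ∈ NontrivB T G v₀ ∧ (CrossesAny X X' ∨ SamePair X X')

/-- The equivalence relation generated by crossing (and identification of equivalent sets
and complements) on `B(T)`. -/
def ccRel (G : Type*) [Group G] [MulAction G V] (v₀ : V) : Set G → Set G → Prop :=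
  Relation.EqvGen (ccStep T G v₀)

/-- The cross-connected component of (the pair determined by) `X`. -/
def ccOf (G : Type*) [Group G] [MulAction G V] (v₀ : V) (X : Set G) : Set (Set G) :=
  {X' | ccRel T G v₀ X X'}

/-- `C` is a cross-connected component of `B(T)`. -/
def IsCCC (G : Type*) [Group G] [MulAction G V] (v₀ : V) (C : Set (Set G)) : Prop :=
  ∃ X ∈ NontrivB T G v₀, C = ccOf T G v₀ X

/-- A cross-connected component is based on the cylinder `Y` if its members are almost
invariant over subgroups in the commensurability class of `Y`. -/
def CCCBasedOn (G : Type*) [Group G] [MulAction G V] (Y : Set (Sym2 V)) (C : Set (Set G)) :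
    Prop :=
  ∃ X ∈ C, ∃ H : Subgroup G, InClassOf G Y H ∧ NontrivAI H X

/-- A peripheral cross-connected component. -/
def PeripheralCCC (G : Type*) [Group G] [MulAction G V] (v₀ : V) (C : Set (Set G)) : Prop :=
  ∃ (Y : Set (Sym2 V)) (v : V), IsCylinder T G Y ∧ v ∈ cylBoundary T Y ∧
    FiniteValenceIn Y v ∧ XvY T G v₀ Y v ∈ C

/-- Betweenness of (distinct) cross-connected components. -/
def CCCBetween {G : Type*} [Group G] (C₁ C₂ C₃ : Set (Set G)) : Prop :=
  C₁ ≠ C₂ ∧ C₂ ≠ C₃ ∧ C₁ ≠ C₃ ∧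
    ∃ X₁ ∈ C₁, ∃ X₂ ∈ C₂, ∃ X₃ ∈ C₃, X₁ ⊆ X₂ ∧ X₂ ⊆ X₃

/-- A star of cross-connected components. -/
def IsStar (G : Type*) [Group G] [MulAction G V] (v₀ : V) (St : Set (Set (Set G))) : Prop :=
  (∀ C ∈ St, IsCCC T G v₀ C) ∧ St.Nontrivial ∧
  (∀ C ∈ St, ∀ C' ∈ St, ∀ C'' : Set (Set G), IsCCC T G v₀ C'' → ¬ CCCBetween C C'' C') ∧
  (∀ St' : Set (Set (Set G)), St ⊆ St' → (∀ C ∈ St', IsCCC T G v₀ C) →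
    (∀ C ∈ St', ∀ C' ∈ St', ∀ C'' : Set (Set G), IsCCC T G v₀ C'' → ¬ CCCBetween C C'' C') →
    St' = St)

/-- The regular neighbourhood `RN(B(T))`: the bipartite graph on cross-connected
components and stars. -/
def RNGraph (G : Type*) [Group G] [MulAction G V] (v₀ : V) :
    SimpleGraph ({C : Set (Set G) // IsCCC T G v₀ C} ⊕
      {St : Set (Set (Set G)) // IsStar T G v₀ St}) where
  Adj x y :=
    match x, y with
    | Sum.inl C, Sum.inr St => C.1 ∈ St.1
    | Sum.inr St, Sum.inl C => C.1 ∈ St.1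
    | _, _ => False
  symm := ⟨by rintro (C | St) (C' | St') h <;> exact h⟩
  loopless := ⟨by rintro (C | St) h <;> exact h⟩

/-- Vertices of `T` lying in at least two cylinders. -/
def TcV0 (G : Type*) [Group G] [MulAction G V] : Set V :=
  {v | ∃ Y Y' : Set (Sym2 V), IsCylinder T G Y ∧ IsCylinder T G Y' ∧ Y ≠ Y' ∧
    v ∈ cylVerts Y ∧ v ∈ cylVerts Y'}

/-- The tree of cylinders `T_c` of `T`, as a bipartite graph. -/
def TcGraph (G : Type*) [Group G] [MulAction G V] :
    SimpleGraph ({v : V // v ∈ TcV0 T G} ⊕ {Y : Set (Sym2 V) // IsCylinder T G Y}) where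
  Adj x y :=
    match x, y with
    | Sum.inl v, Sum.inr Y => v.1 ∈ cylVerts Y.1
    | Sum.inr Y, Sum.inl v => v.1 ∈ cylVerts Y.1
    | _, _ => False
  symm := ⟨by rintro (v | Y) (v' | Y') h <;> exact h⟩
  loopless := ⟨by rintro (v | Y) h <;> exact h⟩


/-- `T` dominates `T'`: there is a `G`-equivariant map. -/
def Dominates (G : Type*) [Group G] {V V' : Type*} [MulAction G V] [MulAction G V']
    (T : SimpleGraph V) (T' : SimpleGraph V') : Prop :=
  ∃ f : V → V', ∀ (g : G) (x : V), f (g • x) = g • f x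

end Tree

section Subdiv

variable {α β : Type*}

/-- `S` is a subdivision of `Γ` via the vertex embedding `f`. -/
def SubdivVia (f : α → β) (S : SimpleGraph β) (Γ : SimpleGraph α) : Prop :=
  Function.Injective f ∧
  (∀ b : β, b ∉ Set.range f → ∃ x y : β, x ≠ y ∧ S.neighborSet b = {x, y}) ∧
  (∀ u : α, Nonempty (Γ.neighborSet u ≃ S.neighborSet (f u))) ∧
  (∀ u v : α, Γ.Adj u v ↔ ∃ p : S.Walk (f u) (f v), p.IsPath ∧ 1 ≤ p.length ∧
      ∀ w ∈ p.support, w ∈ Set.range f → w = f u ∨ w = f v) ∧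
  (∀ e ∈ S.edgeSet, ∃ (u v : α) (p : S.Walk (f u) (f v)), Γ.Adj u v ∧ p.IsPath ∧
      (∀ w ∈ p.support, w ∈ Set.range f → w = f u ∨ w = f v) ∧ e ∈ p.edges)

/-- `S` is (isomorphic to) a subdivision of `Γ`. -/
def IsSubdivision (S : SimpleGraph β) (Γ : SimpleGraph α) : Prop :=
  ∃ f : α → β, SubdivVia f S Γ

end Subdiv

end SSRN

namespace SSRN

section Helpers

theorem HFin.comm_mono {G : Type*} [Group G] {H K : Subgroup G} {X : Set G}
    (h : HFin H X) (hK : K.relIndex H ≠ 0) : HFin K X := by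
  classical
  obtain ⟨F, hF⟩ := h
  have hfin : Finite (H ⧸ K.subgroupOf H) := by
    have : (K.subgroupOf H).index ≠ 0 := hK
    have : (K.subgroupOf H).FiniteIndex := ⟨this⟩
    exact Subgroup.finite_quotient_of_finiteIndex
  have : Fintype (H ⧸ K.subgroupOf H) := Fintype.ofFinite _
  let R : Finset G := Finset.univ.image (fun q : H ⧸ K.subgroupOf H => ((q.out : H) : G)⁻¹)
  refine ⟨(R ×ˢ F).image (fun p => p.1 * p.2), ?_⟩
  intro x hx
  have := hF hx
  simp only [Set.mem_iUnion, Set.mem_image] at this ⊢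
  obtain ⟨f, hf, k, hk, rfl⟩ := this
  let q : H ⧸ K.subgroupOf H := QuotientGroup.mk (⟨k, hk⟩⁻¹ : H)
  have hq : (q.out)⁻¹ * (⟨k, hk⟩⁻¹ : H) ∈ K.subgroupOf H := by
    rw [← QuotientGroup.eq]; exact QuotientGroup.out_eq' q
  have hq2 : k * (q.out : H) ∈ K := by
    have := K.inv_mem (Subgroup.mem_subgroupOf.1 hq)
    simpa using this
  refine ⟨((q.out : H) : G)⁻¹ * f, ?_, k * (q.out : H), hq2, ?_⟩
  · rw [Finset.mem_image]
    exact ⟨(((q.out : H) : G)⁻¹, f), Finset.mem_product.2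
      ⟨Finset.mem_image.2 ⟨q, Finset.mem_univ _, rfl⟩, hf⟩, rfl⟩
  · simp [mul_assoc]

theorem mem_edgeStab {G V : Type*} [Group G] [MulAction G V] {e : Sym2 V} {g : G} :
    g ∈ edgeStab G e ↔ Sym2.map (g • ·) e = e := Iff.rfl

theorem map_smul_mul {G V : Type*} [Group G] [MulAction G V] (e : Sym2 V) (g h : G) :
    Sym2.map ((g * h) • ·) e = Sym2.map (g • ·) (Sym2.map (h • ·) e) := by
  induction e with | _ a b => simp [mul_smul]

theorem map_smul_inv {G V : Type*} [Group G] [MulAction G V] {e e' : Sym2 V} {g : G}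
    (h : Sym2.map (g • ·) e = e') : Sym2.map (g⁻¹ • ·) e' = e := by
  subst h
  induction e with | _ a b => simp

theorem mem_cobdry {V : Type*} (T : SimpleGraph V) (S : Set V) (a b : V) :
    s(a, b) ∈ cobdry T S ↔ T.Adj a b ∧ ¬ (a ∈ S ↔ b ∈ S) := by
  constructor
  · rintro ⟨h, u, v, he, hu, hv⟩
    refine ⟨h, ?_⟩
    rcases Sym2.eq_iff.1 he with ⟨rfl, rfl⟩ | ⟨rfl, rfl⟩ <;> tauto
  · rintro ⟨h, hab⟩
    refine ⟨h, ?_⟩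
    by_cases ha : a ∈ S
    · exact ⟨a, b, rfl, ha, by tauto⟩
    · exact ⟨b, a, Sym2.eq_swap, by tauto, ha⟩

theorem cobdry_compl {V : Type*} (T : SimpleGraph V) (S : Set V) :
    cobdry T Sᶜ = cobdry T S := by
  ext e
  induction e with | _ a b => simp only [mem_cobdry, Set.mem_compl_iff]; tauto

theorem cobdry_symmDiff {V : Type*} (T : SimpleGraph V) (S S' : Set V) :
    cobdry T (S ∆ S') = cobdry T S ∆ cobdry T S' := by
  ext e
  induction e with | _ a b => simp only [mem_cobdry, Set.mem_symmDiff]; tauto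

theorem walk_cross {V : Type*} {T : SimpleGraph V} {S : Set V} {a b : V} (p : T.Walk a b)
    (h : ¬ (a ∈ S ↔ b ∈ S)) : ∃ e ∈ p.edges, e ∈ cobdry T S := by
  induction p with
  | nil => tauto
  | @cons a c b hac p ih =>
    by_cases hc : (a ∈ S ↔ c ∈ S)
    · obtain ⟨e, he, hS⟩ := ih (by tauto)
      exact ⟨e, by simp [he], hS⟩
    · exact ⟨s(a, c), by simp, (mem_cobdry _ _ _ _).2 ⟨hac, hc⟩⟩

theorem cobdry_empty {V : Type*} {T : SimpleGraph V} (hT : T.IsTree) {S : Set V}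
    (h : cobdry T S = ∅) : S = ∅ ∨ S = Set.univ := by
  by_contra! hc
  obtain ⟨⟨x, hx⟩, h2⟩ := hc
  obtain ⟨y, hy⟩ := (Set.ne_univ_iff_exists_notMem _).1 h2
  obtain ⟨p⟩ := hT.1.preconnected x y
  obtain ⟨e, -, he⟩ := walk_cross p (S := S) (by tauto)
  rw [h] at he
  exact he

/-- Convexity of a set whose coboundary is at most one edge. -/
theorem convex_of_cobdry {V : Type*} {T : SimpleGraph V} (hT : T.IsTree) {S : Set V} {e : Sym2 V}
    (h : cobdry T S ⊆ {e}) : ∀ u ∈ S, ∀ v ∈ S, ∀ w : V, Btw T u w v → w ∈ S := by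
  classical
  intro u hu v hv w hw
  by_contra hwS
  obtain ⟨p, hp, -⟩ := hT.existsUnique_path u v
  have hwp := hw p hp
  obtain ⟨e1, h1, h1'⟩ := walk_cross (p.takeUntil w hwp) (S := S) (by tauto)
  obtain ⟨e2, h2, h2'⟩ := walk_cross (p.dropUntil w hwp) (S := S) (by tauto)
  have := h h1'; have := h h2'
  simp only [Set.mem_singleton_iff] at *
  subst e1; subst e2
  have hn := hp.isTrail.edges_nodup
  rw [← p.take_spec hwp, SimpleGraph.Walk.edges_append] at hn
  exact List.disjoint_of_nodup_append hn h1 h2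

theorem halfTree_eq {V : Type*} (T : SimpleGraph V) (u v : V) :
    halfTree T u v = {w | (T.deleteEdges {s(u, v)}).Reachable v w} := by
  classical
  ext w
  constructor
  · rintro ⟨p, -, hp⟩
    exact ⟨p.toDeleteEdges _ (by intro e he h; simp at h; subst h; exact hp he)⟩
  · rintro ⟨p⟩
    refine ⟨(p.toPath.1.mapLe (SimpleGraph.deleteEdges_le _)), ?_, ?_⟩
    · rw [SimpleGraph.Walk.mapLe_isPath]; exact p.toPath.2
    · intro h
      rw [SimpleGraph.Walk.edges_mapLe_eq_edges] at h
      have := SimpleGraph.Walk.edges_subset_edgeSet _ h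
      simp at this

theorem mem_halfTree {V : Type*} (T : SimpleGraph V) (u v : V) : v ∈ halfTree T u v := by
  rw [halfTree_eq]; exact SimpleGraph.Reachable.refl _

theorem notMem_halfTree {V : Type*} {T : SimpleGraph V} (hT : T.IsTree) {u v : V}
    (h : T.Adj u v) : u ∉ halfTree T u v := by
  rw [halfTree_eq]
  intro hr
  have := SimpleGraph.isAcyclic_iff_forall_adj_isBridge.1 hT.2 h
  rw [SimpleGraph.isBridge_iff] at this
  exact this hr.symm

theorem cobdry_halfTree {V : Type*} {T : SimpleGraph V} (hT : T.IsTree) {u v : V}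
    (h : T.Adj u v) : cobdry T (halfTree T u v) = {s(u, v)} := by
  ext e
  induction e with | _ a b =>
  rw [mem_cobdry, Set.mem_singleton_iff]
  constructor
  · rintro ⟨hab, hn⟩
    by_contra hne
    apply hn
    have had : (T.deleteEdges {s(u, v)}).Adj a b := by
      rw [SimpleGraph.deleteEdges_adj]; exact ⟨hab, hne⟩
    rw [halfTree_eq]
    exact ⟨fun h => h.trans had.reachable, fun h => h.trans had.symm.reachable⟩
  · intro he
    have h1 := mem_halfTree T u v
    have h2 := notMem_halfTree hT h
    rcases Sym2.eq_iff.1 he with ⟨rfl, rfl⟩ | ⟨rfl, rfl⟩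
    · exact ⟨h, by tauto⟩
    · exact ⟨h.symm, by tauto⟩

/-- The graph homomorphism given by a group element. -/
def actHom {G V : Type*} [Group G] [MulAction G V] {T : SimpleGraph V} (hact : ActsOn T G)
    (g : G) : T →g T := ⟨(g • ·), fun {a b} h => hact g a b h⟩

theorem hull {G V : Type*} [Group G] [MulAction G V] {T : SimpleGraph V}
    (hact : ActsOn T G) (hmin : MinimalAction T G)
    {B C : Set V} (hB : B.Nonempty) (hBi : ∀ g : G, ∀ b ∈ B, g • b ∈ B)
    (hC : ∀ u ∈ C, ∀ v ∈ C, ∀ w : V, Btw T u w v → w ∈ C) (hBC : B ⊆ C) : C = Set.univ := by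
  let A : Set V := {w | ∀ D : Set V, (∀ u ∈ D, ∀ v ∈ D, ∀ w : V, Btw T u w v → w ∈ D) →
    B ⊆ D → w ∈ D}
  have hA : A = Set.univ := by
    apply hmin
    · obtain ⟨b, hb⟩ := hB
      exact ⟨b, fun D _ h => h hb⟩
    · intro g a ha D hD hBD
      refine ha {x | g • x ∈ D} ?_ (fun b hb => hBD (hBi g b hb))
      intro u hu v hv w hw
      refine hD _ hu _ hv _ ?_
      intro p hp
      have hinj : Function.Injective (actHom hact g⁻¹) := MulAction.injective g⁻¹
      have hgu : actHom hact g⁻¹ (g • u) = u := inv_smul_smul g u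
      have hgv : actHom hact g⁻¹ (g • v) = v := inv_smul_smul g v
      have h1 := hw ((p.map (actHom hact g⁻¹)).copy hgu hgv)
        (by rw [SimpleGraph.Walk.isPath_copy]; exact SimpleGraph.Walk.map_isPath_of_injective hinj hp)
      rw [SimpleGraph.Walk.support_copy, SimpleGraph.Walk.support_map, List.mem_map] at h1
      obtain ⟨x, hx, hxw⟩ := h1
      have : g • w = x := by rw [← hxw]; exact smul_inv_smul g x
      rw [this]; exact hx
    · intro u hu v hv w hw D hD hBD
      exact hD u (hu D hD hBD) v (hv D hD hBD) w hw
  rw [Set.eq_univ_iff_forall]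
  intro x
  have : x ∈ A := hA ▸ Set.mem_univ x
  exact this C hC hBC

/-- Both sides of an edge meet any nonempty invariant set. -/
theorem both_sides {G V : Type*} [Group G] [MulAction G V] {T : SimpleGraph V} (hT : T.IsTree)
    (hact : ActsOn T G) (hmin : MinimalAction T G)
    {B : Set V} (hB : B.Nonempty) (hBi : ∀ g : G, ∀ b ∈ B, g • b ∈ B) {u v : V} (h : T.Adj u v) :
    ¬ B ⊆ halfTree T u v ∧ ¬ B ⊆ (halfTree T u v)ᶜ := by
  constructor
  · intro hs
    have := hull hact hmin hB hBi (convex_of_cobdry hT (cobdry_halfTree hT h).le) hs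
    exact notMem_halfTree hT h (this ▸ Set.mem_univ u)
  · intro hs
    have := hull hact hmin hB hBi (convex_of_cobdry hT
      ((cobdry_compl T _).trans (cobdry_halfTree hT h)).le) hs
    have h2 : v ∈ (halfTree T u v)ᶜ := this ▸ Set.mem_univ v
    exact h2 (mem_halfTree T u v)

theorem finEdgeOrbits {G V : Type*} [Group G] [MulAction G V] (hG : Group.FG G)
    {T : SimpleGraph V} (hT : T.IsTree) (hact : ActsOn T G) (hmin : MinimalAction T G) (v₀ : V) :
    FinEdgeOrbits T G := by
  classical
  obtain ⟨S, hS⟩ := hG.out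
  choose p hp using fun s : G => hT.1.preconnected v₀ (s • v₀) |>.elim
    (fun q => (⟨q, trivial⟩ : ∃ q : T.Walk v₀ (s • v₀), True))
  refine ⟨S.biUnion fun s => (p s).edges.toFinset, ?_⟩
  intro e he
  induction e with | _ u v =>
  have huv : T.Adj u v := he
  have hcr : ∃ g : G, ∃ s ∈ S, ¬ (g • v₀ ∈ halfTree T u v ↔ (g * s) • v₀ ∈ halfTree T u v) := by
    by_contra! hc
    have key : ∀ k : G, k ∈ Subgroup.closure (S : Set G) →
        ∀ g : G, (g • v₀ ∈ halfTree T u v ↔ (g * k) • v₀ ∈ halfTree T u v) := by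
      intro k hk
      induction hk using Subgroup.closure_induction with
      | mem x hx => intro g; exact hc g x hx
      | one => intro g; simp
      | mul x y _ _ hx hy => intro g; rw [hx g, hy (g * x), mul_assoc]
      | inv x _ hx => intro g; rw [hx (g * x⁻¹)]; simp
    have hb := both_sides hT hact hmin (B := Set.range fun g : G => g • v₀) ⟨_, 1, rfl⟩
      (by rintro g _ ⟨k, rfl⟩; exact ⟨g * k, mul_smul g k v₀⟩) huv
    have key' : ∀ k : G, v₀ ∈ halfTree T u v ↔ k • v₀ ∈ halfTree T u v := by
      intro k
      have := key k (by rw [hS]; trivial) 1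
      simpa using this
    by_cases h0 : v₀ ∈ halfTree T u v
    · apply hb.1; rintro _ ⟨k, rfl⟩; exact (key' k).1 h0
    · apply hb.2; rintro _ ⟨k, rfl⟩ hk; exact h0 ((key' k).2 hk)
  obtain ⟨g, s, hs, hgs⟩ := hcr
  rw [mul_smul] at hgs
  obtain ⟨e, he1, he2⟩ := walk_cross ((p s).map (actHom hact g)) hgs
  rw [cobdry_halfTree hT huv, Set.mem_singleton_iff] at he2
  rw [SimpleGraph.Walk.edges_map, List.mem_map] at he1
  obtain ⟨e0, he0, rfl⟩ := he1
  exact ⟨e0, Finset.mem_biUnion.2 ⟨s, hs, List.mem_toFinset.2 he0⟩, g, he2⟩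

/-- An edge of `T` in the coboundary of the preimage of a half-tree has smaller stabilizer. -/
theorem stab_le {G V V' : Type*} [Group G] [MulAction G V] [MulAction G V']
    {T : SimpleGraph V} {T' : SimpleGraph V'} (hT' : T'.IsTree)
    (hact' : ActsOn T' G) (hinv : NoInversions T G)
    (f : V → V') (hf : ∀ (g : G) (x : V), f (g • x) = g • f x) {u' v' : V'} (h : T'.Adj u' v')
    {e : Sym2 V} (he : e ∈ cobdry T (f ⁻¹' halfTree T' u' v')) :
    edgeStab G e ≤ edgeStab G s(u', v') := by
  induction e with | _ a b =>
  rw [mem_cobdry] at he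
  obtain ⟨hab, hn⟩ := he
  intro g hg
  rw [mem_edgeStab, Sym2.map_mk] at hg
  have hfix : g • a = a ∧ g • b = b := by
    rcases Sym2.eq_iff.1 hg with h | h
    · exact h
    · exact absurd h (hinv g a b hab)
  obtain ⟨p, hp, hu⟩ := hT'.existsUnique_path (f a) (f b)
  have ha : actHom hact' g (f a) = f a := by
    show g • f a = f a
    rw [← hf, hfix.1]
  have hb : actHom hact' g (f b) = f b := by
    show g • f b = f b
    rw [← hf, hfix.2]
  have hinj : Function.Injective (actHom hact' g) := MulAction.injective g
  have hq := hu ((p.map (actHom hact' g)).copy ha hb)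
    (by dsimp only; rw [SimpleGraph.Walk.isPath_copy]; exact SimpleGraph.Walk.map_isPath_of_injective hinj hp)
  have hq2 := congrArg SimpleGraph.Walk.edges hq
  rw [SimpleGraph.Walk.edges_copy, SimpleGraph.Walk.edges_map] at hq2
  obtain ⟨e, he1, he2⟩ := walk_cross p (S := halfTree T' u' v') hn
  rw [cobdry_halfTree hT' h, Set.mem_singleton_iff] at he2
  subst he2
  rw [mem_edgeStab]
  have h3 : p.edges.map (Sym2.map (actHom hact' g)) = p.edges.map id := by rw [hq2, List.map_id]
  exact List.map_inj_left.1 h3 _ he1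

theorem orbit_finite {G V : Type*} [Group G] [MulAction G V] (e : Sym2 V) (H : Subgroup G)
    (h : (edgeStab G e).relIndex H ≠ 0) : {e' | ∃ k ∈ H, Sym2.map (k • ·) e = e'}.Finite := by
  have hfin : Finite (H ⧸ (edgeStab G e).subgroupOf H) := by
    have : ((edgeStab G e).subgroupOf H).FiniteIndex := ⟨h⟩
    exact Subgroup.finite_quotient_of_finiteIndex
  refine (Set.finite_range (fun q : H ⧸ (edgeStab G e).subgroupOf H =>
    Sym2.map (((q.out : H) : G) • ·) e)).subset ?_
  rintro _ ⟨k, hk, rfl⟩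
  let q : H ⧸ (edgeStab G e).subgroupOf H := QuotientGroup.mk (⟨k, hk⟩ : H)
  refine ⟨q, ?_⟩
  have hq : (q.out)⁻¹ * (⟨k, hk⟩ : H) ∈ (edgeStab G e).subgroupOf H := by
    rw [← QuotientGroup.eq]; exact QuotientGroup.out_eq' q
  have hq2 : ((q.out : H) : G)⁻¹ * k ∈ edgeStab G e := Subgroup.mem_subgroupOf.1 hq
  rw [mem_edgeStab] at hq2
  have h3 : k = ((q.out : H) : G) * (((q.out : H) : G)⁻¹ * k) := by simp
  show Sym2.map (((q.out : H) : G) • ·) e = _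
  conv_rhs => rw [h3, map_smul_mul, hq2]

theorem cobdry_finite {G V V' : Type*} [Group G] [MulAction G V] [MulAction G V']
    {T : SimpleGraph V} {T' : SimpleGraph V'} (hT' : T'.IsTree)
    (hact' : ActsOn T' G) (hinv : NoInversions T G) (hfo : FinEdgeOrbits T G)
    (hidx : ∀ e ∈ T.edgeSet, ∀ e' ∈ T'.edgeSet,
      edgeStab G e ≤ edgeStab G e' → (edgeStab G (V := V) e).relIndex (edgeStab G e') ≠ 0)
    (f : V → V') (hf : ∀ (g : G) (x : V), f (g • x) = g • f x) {u' v' : V'} (h : T'.Adj u' v') :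
    (cobdry T (f ⁻¹' halfTree T' u' v')).Finite := by
  classical
  obtain ⟨E, hE⟩ := hfo
  have hN : ∀ e : Sym2 V, ∃ N : Finset (Sym2 V'), ∀ g : G,
      Sym2.map (g • ·) e ∈ cobdry T (f ⁻¹' halfTree T' u' v') →
        ∃ n ∈ N, Sym2.map (g • ·) n = s(u', v') := by
    intro e
    induction e with | _ a b =>
    obtain ⟨p⟩ := hT'.1.preconnected (f a) (f b)
    refine ⟨p.edges.toFinset, ?_⟩
    intro g hg
    rw [Sym2.map_mk, mem_cobdry] at hg
    have hg2 := hg.2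
    rw [Set.mem_preimage, Set.mem_preimage, hf, hf] at hg2
    obtain ⟨e, he1, he2⟩ := walk_cross (p.map (actHom hact' g)) hg2
    rw [cobdry_halfTree hT' h, Set.mem_singleton_iff] at he2
    rw [SimpleGraph.Walk.edges_map, List.mem_map] at he1
    obtain ⟨e0, he0, rfl⟩ := he1
    exact ⟨e0, List.mem_toFinset.2 he0, he2⟩
  choose N hN using hN
  have hsub : cobdry T (f ⁻¹' halfTree T' u' v') ⊆ ⋃ e ∈ E, ⋃ n ∈ N e,
      {x | x ∈ cobdry T (f ⁻¹' halfTree T' u' v') ∧ ∃ g : G, Sym2.map (g • ·) e = x ∧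
        Sym2.map (g • ·) n = s(u', v')} := by
    intro x hx
    obtain ⟨e, he, g, rfl⟩ := hE x hx.1
    obtain ⟨n, hn, hgn⟩ := hN e g hx
    simp only [Set.mem_iUnion]
    exact ⟨e, he, n, hn, hx, g, rfl, hgn⟩
  refine Set.Finite.subset ?_ hsub
  refine Set.Finite.biUnion E.finite_toSet fun e _ => Set.Finite.biUnion (N e).finite_toSet fun n _ => ?_
  rcases Set.eq_empty_or_nonempty {x | x ∈ cobdry T (f ⁻¹' halfTree T' u' v') ∧
    ∃ g : G, Sym2.map (g • ·) e = x ∧ Sym2.map (g • ·) n = s(u', v')} with h0 | ⟨x, hx, g₀, hg₀, hn₀⟩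
  · rw [h0]; exact Set.finite_empty
  · refine (orbit_finite x (edgeStab G s(u', v')) (hidx x hx.1 _ h
      (stab_le hT' hact' hinv f hf h hx))).subset ?_
    rintro y ⟨hy, g, hg, hn⟩
    refine ⟨g * g₀⁻¹, ?_, ?_⟩
    · rw [mem_edgeStab, map_smul_mul, map_smul_inv hn₀, hn]
    · rw [map_smul_mul, map_smul_inv hg₀, hg]

theorem basepoint_change {G V : Type*} [Group G] [MulAction G V]
    {T : SimpleGraph V} (hT : T.IsTree) (hact : ActsOn T G) (x y : V) {u v : V} (h : T.Adj u v) :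
    HFin (edgeStab G s(u, v)) (XS G x (halfTree T u v) ∆ XS G y (halfTree T u v)) := by
  classical
  obtain ⟨p⟩ := hT.1.preconnected x y
  let k : Sym2 V → G := fun n =>
    if hn : ∃ g : G, Sym2.map (g • ·) n = s(u, v) then hn.choose else 1
  refine ⟨p.edges.toFinset.image k, ?_⟩
  intro g hg
  have hg2 : ¬ (g • x ∈ halfTree T u v ↔ g • y ∈ halfTree T u v) := by
    have h1 : (g • x ∈ halfTree T u v ∧ ¬ g • y ∈ halfTree T u v) ∨
      (g • y ∈ halfTree T u v ∧ ¬ g • x ∈ halfTree T u v) := hg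
    tauto
  obtain ⟨e, he1, he2⟩ := walk_cross (p.map (actHom hact g)) hg2
  rw [cobdry_halfTree hT h, Set.mem_singleton_iff] at he2
  rw [SimpleGraph.Walk.edges_map, List.mem_map] at he1
  obtain ⟨n, hn, rfl⟩ := he1
  have hgn : Sym2.map (g • ·) n = s(u, v) := he2
  have hex : ∃ g : G, Sym2.map (g • ·) n = s(u, v) := ⟨g, hgn⟩
  have hk : Sym2.map (k n • ·) n = s(u, v) := by
    simp only [k, dif_pos hex]; exact hex.choose_spec
  simp only [Set.mem_iUnion, Set.mem_image]
  refine ⟨k n, Finset.mem_image.2 ⟨n, List.mem_toFinset.2 hn, rfl⟩, g * (k n)⁻¹, ?_, by simp⟩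
  show g * (k n)⁻¹ ∈ edgeStab G s(u, v)
  rw [mem_edgeStab, map_smul_mul, map_smul_inv hk, hgn]

/-- A vertex set with finite coboundary inside `Y` gives a member of the Boolean algebra. -/
theorem mem_of_finite_cobdry {G V : Type*} [Group G] [MulAction G V]
    {T : SimpleGraph V} (hT : T.IsTree) (v₀ : V) {Y : Set (Sym2 V)} {F : Set (Set G)}
    (hne : ∃ X, X ∈ F)
    (hgen : ∀ u v : V, T.Adj u v → s(u, v) ∈ Y → Ze T G v₀ u v ∈ F)
    (hc : ∀ X ∈ F, Xᶜ ∈ F) (hi : ∀ X ∈ F, ∀ X' ∈ F, X ∩ X' ∈ F)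
    (n : ℕ) : ∀ S : Set V, (cobdry T S).Finite → (cobdry T S).ncard = n → cobdry T S ⊆ Y →
      XS G v₀ S ∈ F := by
  have hsd : ∀ X ∈ F, ∀ X' ∈ F, X ∆ X' ∈ F := by
    intro X hX X' hX'
    have : X ∆ X' = ((X ∩ X'ᶜ)ᶜ ∩ (X' ∩ Xᶜ)ᶜ)ᶜ := by
      ext x; simp only [Set.mem_symmDiff, Set.mem_compl_iff, Set.mem_inter_iff]; tauto
    rw [this]
    exact hc _ (hi _ (hc _ (hi _ hX _ (hc _ hX'))) _ (hc _ (hi _ hX' _ (hc _ hX))))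
  induction n with
  | zero =>
    intro S hfin hn _
    rw [Set.ncard_eq_zero hfin] at hn
    obtain ⟨X, hX⟩ := hne
    have hE : (∅ : Set G) ∈ F := by
      have := hi X hX _ (hc X hX); rwa [Set.inter_compl_self] at this
    rcases cobdry_empty hT hn with rfl | rfl
    · exact hE
    · have := hc _ hE
      rw [Set.compl_empty] at this; exact this
  | succ n ih =>
    intro S hfin hn hY
    obtain ⟨e, he⟩ : (cobdry T S).Nonempty := by
      apply Set.nonempty_of_ncard_ne_zero; omega
    induction e with | _ u v =>
    have huv : T.Adj u v := he.1
    have hcb : cobdry T (S ∆ halfTree T u v) = cobdry T S \ {s(u, v)} := by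
      rw [cobdry_symmDiff, cobdry_halfTree hT huv]
      ext x
      simp only [Set.mem_symmDiff, Set.mem_singleton_iff, Set.mem_diff]
      constructor
      · rintro (h | ⟨rfl, h⟩)
        · exact h
        · exact absurd he h
      · exact Or.inl
    have h1 : XS G v₀ (S ∆ halfTree T u v) ∈ F := by
      apply ih
      · rw [hcb]; exact hfin.diff
      · rw [hcb, Set.ncard_diff_singleton_of_mem he, hn]; rfl
      · rw [hcb]; exact Set.diff_subset.trans hY
    have h2 := hsd _ h1 _ (hgen u v huv (hY he))
    have h3 : XS G v₀ (S ∆ halfTree T u v) ∆ Ze T G v₀ u v = XS G v₀ S := by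
      have : XS G v₀ (S ∆ halfTree T u v) = XS G v₀ S ∆ Ze T G v₀ u v := rfl
      rw [this, symmDiff_symmDiff_cancel_right]
    rwa [h3] at h2

end Helpers

/-- If no edge stabilizer of `T` is contained with infinite index in an
edge stabilizer of `T'`, and `T` dominates `T'`, then `B(T') ⊆ B(T)`. -/
theorem stmt_2 {G V V' : Type*} [Group G] [MulAction G V] [MulAction G V']
    (hGfg : Group.FG G)
    (T : SimpleGraph V) (T' : SimpleGraph V') (hT : T.IsTree) (hT' : T'.IsTree)
    (hact : ActsOn T G) (hact' : ActsOn T' G)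
    (hinv : NoInversions T G) (hinv' : NoInversions T' G)
    (hmin : MinimalAction T G) (hmin' : MinimalAction T' G)
    (v₀ : V) (v₀' : V')
    (hidx : ∀ e ∈ T.edgeSet, ∀ e' ∈ T'.edgeSet,
      edgeStab G e ≤ edgeStab G e' → (edgeStab G (V := V) e).relIndex (edgeStab G e') ≠ 0)
    (hdom : Dominates G T T') :
    BT T' G v₀' ⊆ BT T G v₀ := by
  obtain ⟨f, hf⟩ := hdom
  have hfo := finEdgeOrbits hGfg hT hact hmin v₀
  rintro X ⟨Y', hY', e', he', hX⟩
  have hcomm : ∀ u' v' : V', T'.Adj u' v' → ∀ e ∈ cobdry T (f ⁻¹' halfTree T' u' v'),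
      Subgroup.Commensurable (edgeStab G e) (edgeStab G s(u', v')) := by
    intro u' v' h e he
    have hle := stab_le hT' hact' hinv f hf h he
    refine ⟨hidx e he.1 _ h hle, ?_⟩
    rw [Subgroup.relIndex_eq_one.2 hle]
    exact one_ne_zero
  have hnonempty : ∀ u' v' : V', T'.Adj u' v' →
      (cobdry T (f ⁻¹' halfTree T' u' v')).Nonempty := by
    intro u' v' h
    by_contra hne
    have hb := both_sides hT' hact' hmin' (B := Set.range f) ⟨_, v₀, rfl⟩
      (by rintro g _ ⟨k, rfl⟩; exact ⟨g • k, hf g k⟩) h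
    rcases cobdry_empty hT (Set.not_nonempty_iff_eq_empty.1 hne) with h0 | h0
    · apply hb.2
      rintro _ ⟨k, rfl⟩ hk
      have : k ∈ f ⁻¹' halfTree T' u' v' := hk
      rw [h0] at this; exact this
    · apply hb.1
      rintro _ ⟨k, rfl⟩
      have : k ∈ f ⁻¹' halfTree T' u' v' := h0 ▸ Set.mem_univ k
      exact this
  let Y : Set (Sym2 V) := {e | e ∈ T.edgeSet ∧
    Subgroup.Commensurable (edgeStab G e) (edgeStab G e')}
  have hYne : Y.Nonempty := by
    obtain ⟨u', v', huv⟩ : ∃ u' v', e' = s(u', v') := by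
      induction e' with | _ a b => exact ⟨a, b, rfl⟩
    have h : T'.Adj u' v' := by
      have := hY'.2.1 he'
      rwa [huv] at this
    obtain ⟨x, hx⟩ := hnonempty u' v' h
    exact ⟨x, hx.1, huv ▸ hcomm u' v' h x hx⟩
  obtain ⟨e, heY⟩ := hYne
  refine ⟨Y, ⟨⟨e, heY⟩, fun _ h => h.1, ?_⟩, e, heY, ?_⟩
  · intro e₁ h₁ e₂ h₂
    constructor
    · intro h; exact h₁.2.trans h.2.symm
    · intro h; exact ⟨h₂, h.symm.trans h₁.2⟩
  · rintro F ⟨hgen, hc, hi, hq⟩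
    refine hX F ⟨?_, hc, hi, ?_⟩
    · intro u' v' h huv
      have hcm : Subgroup.Commensurable (edgeStab G e') (edgeStab G s(u', v')) :=
        (hY'.2.2 e' he' _ h).1 huv
      have h1 : XS G v₀ (f ⁻¹' halfTree T' u' v') ∈ F := by
        refine mem_of_finite_cobdry hT v₀ ?_ hgen hc hi _ _
          (cobdry_finite hT' hact' hinv hfo hidx f hf h) rfl
          (fun x hx => ⟨hx.1, (hcomm _ _ h x hx).trans hcm.symm⟩)
        obtain ⟨a, b⟩ := e
        exact ⟨_, hgen a b heY.1 heY⟩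
      refine hq _ h1 _ ?_
      have h2 : XS G v₀ (f ⁻¹' halfTree T' u' v') = XS G (f v₀) (halfTree T' u' v') := by
        ext g; simp [XS, hf]
      rw [h2]
      exact (basepoint_change hT' hact' (f v₀) v₀' h).comm_mono (heY.2.trans hcm).1
    · intro Z hZ Z' hZZ
      exact hq Z hZ Z' (hZZ.comm_mono heY.2.1)

end SSRN
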